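/- arXiv:1805.05998 — 2 statements merged into one kernel-verified Lean document; each statement's English description precedes it below -/
import Mathlib

section
/- Let A be a separable unital C*-algebra with compact generating set K and let a ∈ A. Then ω^K_a coincides pointwise with the minimal concave modulus of continuity of the map â : (Rep(A),d_K) → B(ℓ²), â(π)=π(a); that is, ω^K_a(t) = inf{ω(t) : ω ∈ Ω and ‖π(a) − π'(a)‖ ≤ ω(d_K(π,π')) for all π,π' ∈ Rep(A)} for every t ≥ 0. -/
noncomputable section

abbrev H2 : Type := lp (fun _ : ℕ => ℂ) 2
abbrev BH : Type := H2 →L[ℂ] H2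

abbrev RepSp (A : Type*) [CStarAlgebra A] := A →⋆ₐ[ℂ] BH

def Generates {A : Type*} [CStarAlgebra A] (K : Set A) : Prop :=
  (StarAlgebra.adjoin ℂ K).topologicalClosure = ⊤

def dRep {A : Type*} [CStarAlgebra A] (K : Set A) (π₁ π₂ : RepSp A) : ℝ :=
  ⨆ a ∈ K, ‖π₁ a - π₂ a‖

/-- A modulus of continuity: a continuous, nondecreasing, concave function
`[0,∞) → [0,∞)` vanishing at `0`. -/
def IsModulus (ω : ℝ → ℝ) : Prop :=
  ContinuousOn ω (Set.Ici 0) ∧ MonotoneOn ω (Set.Ici 0) ∧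
    ConcaveOn ℝ (Set.Ici 0) ω ∧ ω 0 = 0 ∧ ∀ t ∈ Set.Ici (0 : ℝ), 0 ≤ ω t

/-- `f^K_a(t) = sup {‖π(a) - π'(a)‖ : d_K(π,π') ≤ t}`. -/
def fModPt {A : Type*} [CStarAlgebra A] (K : Set A) (a : A) (t : ℝ) : ℝ :=
  sSup {r : ℝ | ∃ π π' : RepSp A, dRep K π π' ≤ t ∧ r = ‖π a - π' a‖}

/-- `ω^K_a(t) = inf {ω(t) : ω ∈ Ω, ω ≥ f^K_a on [0,∞)}`. -/
def omegaPt {A : Type*} [CStarAlgebra A] (K : Set A) (a : A) (t : ℝ) : ℝ :=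
  sInf {y : ℝ | ∃ ω : ℝ → ℝ, IsModulus ω ∧
    (∀ s ∈ Set.Ici (0 : ℝ), fModPt K a s ≤ ω s) ∧ y = ω t}

lemma dRep_nonneg {A : Type*} [CStarAlgebra A] (K : Set A) (π π' : RepSp A) :
    0 ≤ dRep K π π' :=
  Real.iSup_nonneg fun _ => Real.iSup_nonneg fun _ => norm_nonneg _

lemma norm_sub_le_fModPt {A : Type*} [CStarAlgebra A] (K : Set A) (a : A) {t : ℝ}
    {π π' : RepSp A} (h : dRep K π π' ≤ t) : ‖π a - π' a‖ ≤ fModPt K a t := by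
  refine le_csSup ⟨‖a‖ + ‖a‖, ?_⟩ ⟨π, π', h, rfl⟩
  rintro _ ⟨ρ, ρ', -, rfl⟩
  exact (norm_sub_le _ _).trans
    (add_le_add (NonUnitalStarAlgHom.norm_apply_le ρ a) (NonUnitalStarAlgHom.norm_apply_le ρ' a))

/-- A modulus dominates `f^K_a` exactly when it is a modulus of continuity of `π ↦ π a`. -/
lemma IsModulus.fModPt_le_iff {A : Type*} [CStarAlgebra A] (K : Set A) (a : A) {ω : ℝ → ℝ}
    (hω : IsModulus ω) :
    (∀ s ∈ Set.Ici (0 : ℝ), fModPt K a s ≤ ω s) ↔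
      ∀ π π' : RepSp A, ‖π a - π' a‖ ≤ ω (dRep K π π') := by
  obtain ⟨-, hmono, -, -, hnonneg⟩ := hω
  constructor
  · intro h π π'
    exact (norm_sub_le_fModPt K a le_rfl).trans (h _ (dRep_nonneg K π π'))
  · intro h s hs
    refine Real.sSup_le ?_ (hnonneg s hs)
    rintro _ ⟨π, π', hd, rfl⟩
    exact (h π π').trans (hmono (dRep_nonneg K π π') hs hd)

theorem stmt9 (A : Type*) [CStarAlgebra A] [TopologicalSpace.SeparableSpace A]
    (K : Set A) (hK : IsCompact K) (hgen : Generates K) (a : A) :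
    ∀ t : ℝ, 0 ≤ t →
      omegaPt K a t =
        sInf {y : ℝ | ∃ ω : ℝ → ℝ, IsModulus ω ∧
          (∀ π π' : RepSp A, ‖π a - π' a‖ ≤ ω (dRep K π π')) ∧ y = ω t} := by
  intro t _
  unfold omegaPt
  congr 1
  ext y
  exact exists_congr fun ω => and_congr_right fun hω =>
    and_congr_left fun _ => hω.fModPt_le_iff K a
end
end

section
/- Let A be a separable unital C*-algebra that is compact (i.e. Σ(A) is a compact subset of (Rep(A), d_K) for a compact generating set K of A). Then every irreducible unital *-representation of A is finite-dimensional: for every nonzero complex Hilbert space H and every unital *-homomorphism π : A → B(H) whose commutant is trivial (every bounded operator commuting with all π(a) is a scalar multiple of the identity), the dimension of H is finite. -/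
noncomputable section

abbrev lpE (n : ℕ) : Type := lp (fun _ : ℕ => EuclideanSpace ℂ (Fin n)) 2

/-- A representation is irreducible if its commutant is trivial. -/
def IsIrredRep {A : Type*} [CStarAlgebra A] (π : RepSp A) : Prop :=
  ∀ T : BH, (∀ a : A, T * π a = π a * T) → ∃ c : ℂ, T = c • (1 : BH)

/-- `Σ⁰(A)`: irreducible representations on `ℓ²`, together with the countable
amplifications `ℵ₀ ⊙ ρ` of finite-dimensional irreducible representations `ρ`. -/
def Sigma0 (A : Type*) [CStarAlgebra A] : Set (RepSp A) :=
  {π | IsIrredRep π ∨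
    ∃ n : ℕ, 0 < n ∧ ∃ ρ : A →⋆ₐ[ℂ] Matrix (Fin n) (Fin n) ℂ,
      (∀ T : Matrix (Fin n) (Fin n) ℂ, (∀ a : A, T * ρ a = ρ a * T) →
        ∃ c : ℂ, T = c • (1 : Matrix (Fin n) (Fin n) ℂ)) ∧
      ∃ u : H2 ≃ₗᵢ[ℂ] lpE n, ∀ (a : A) (f : lpE n) (k : ℕ),
        u (π a (u.symm f)) k = Matrix.toEuclideanLin (ρ a) (f k)}

/-- `Σ(A)`: the closure of `Σ⁰(A)` with respect to the metric `d_K`. -/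
def SigmaSet {A : Type*} [CStarAlgebra A] (K : Set A) : Set (RepSp A) :=
  {π | ∀ ε > (0 : ℝ), ∃ π' ∈ Sigma0 A, dRep K π π' < ε}

/-- Sequential compactness of a set of representations with respect to `d_K`;
for the metric space `(Rep(A), d_K)` this is equivalent to compactness. -/
def RepSeqCompact {A : Type*} [CStarAlgebra A] (K : Set A) (S : Set (RepSp A)) : Prop :=
  ∀ u : ℕ → RepSp A, (∀ n, u n ∈ S) →
    ∃ π ∈ S, ∃ φ : ℕ → ℕ, StrictMono φ ∧
      Filter.Tendsto (fun n => dRep K (u (φ n)) π) Filter.atTop (nhds 0)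

universe u

section HilbertSpace

variable {H : Type*} [NormedAddCommGroup H] [InnerProductSpace ℂ H]

theorem Orthonormal.one_le_norm_sub {ι : Type*} {v : ι → H} (hv : Orthonormal ℂ v) {i j : ι}
    (hij : i ≠ j) : 1 ≤ ‖v i - v j‖ := by
  have h := @norm_sub_sq ℂ H _ _ _ (v i) (v j)
  rw [hv.2 hij, hv.1 i, hv.1 j] at h
  norm_num at h
  nlinarith [norm_nonneg (v i - v j)]

theorem Orthonormal.countable_of_separableSpace [TopologicalSpace.SeparableSpace H]
    {ι : Type*} {v : ι → H} (hv : Orthonormal ℂ v) : Countable ι := by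
  refine Pairwise.countable_of_isOpen_disjoint (s := fun i => Metric.ball (v i) (1 / 2)) ?_
    (fun _ => Metric.isOpen_ball) (fun i => ⟨v i, Metric.mem_ball_self (by norm_num)⟩)
  intro i j hij
  refine Metric.ball_disjoint_ball ?_
  rw [dist_eq_norm]
  linarith [hv.one_le_norm_sub hij]

theorem HilbertBasis.infinite_of_not_finiteDimensional {ι : Type*} (b : HilbertBasis ι ℂ H)
    (hH : ¬ FiniteDimensional ℂ H) : Infinite ι := by
  by_contra hι
  rw [not_infinite_iff_finite] at hι
  have := Fintype.ofFinite ι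
  exact hH b.toOrthonormalBasis.toBasis.finiteDimensional_of_finite

theorem exists_orthonormal_nat [CompleteSpace H] (hH : ¬ FiniteDimensional ℂ H) :
    ∃ v : ℕ → H, Orthonormal ℂ v := by
  obtain ⟨w, b, -⟩ := exists_hilbertBasis ℂ H
  have := b.infinite_of_not_finiteDimensional hH
  exact ⟨_, b.orthonormal.comp _ (Infinite.natEmbedding w).injective⟩

theorem exists_linearIsometryEquiv_lp_nat [CompleteSpace H] [TopologicalSpace.SeparableSpace H]
    (hH : ¬ FiniteDimensional ℂ H) : Nonempty (H ≃ₗᵢ[ℂ] lp (fun _ : ℕ => ℂ) 2) := by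
  obtain ⟨w, b, -⟩ := exists_hilbertBasis ℂ H
  have := b.infinite_of_not_finiteDimensional hH
  have := b.orthonormal.countable_of_separableSpace
  obtain ⟨e⟩ := nonempty_equiv_of_countable (α := ℕ) (β := w)
  refine ⟨(HilbertBasis.mk (b.orthonormal.comp e e.injective) ?_).repr⟩
  rw [e.surjective.range_comp, b.dense_span]

theorem not_finiteDimensional_orthogonal (S : Submodule ℂ H) [FiniteDimensional ℂ S]
    (hH : ¬ FiniteDimensional ℂ H) : ¬ FiniteDimensional ℂ Sᗮ := by
  intro h
  have := Submodule.finiteDimensional_sup S Sᗮ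
  rw [Submodule.sup_orthogonal_of_hasOrthogonalProjection] at this
  exact hH (Submodule.topEquiv.finiteDimensional)

/-- The complex reflection along `x - y` exchanges orthogonal vectors of equal norm, and it fixes
what is orthogonal to both of them. -/
theorem exists_linearIsometryEquiv_fix_and_map {e x y : H} (hex : inner ℂ x e = 0)
    (hey : inner ℂ y e = 0) (hxy : inner ℂ x y = 0) (hn : ‖x‖ = ‖y‖) :
    ∃ R : H ≃ₗᵢ[ℂ] H, R e = e ∧ R x = y := by
  have hyx : inner ℂ y x = 0 := inner_eq_zero_symm.mp hxy
  set R := (ℂ ∙ (x - y))ᗮ.reflection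
  have hsum : R (x + y) = x + y := by
    refine Submodule.reflection_mem_subspace_eq_self ?_
    rw [Submodule.mem_orthogonal_singleton_iff_inner_right]
    simp [inner_sub_left, inner_add_right, hxy, hyx, inner_self_eq_norm_sq_to_K, hn]
  have hdiff : R (x - y) = -(x - y) :=
    Submodule.reflection_orthogonalComplement_singleton_eq_neg _
  refine ⟨R, Submodule.reflection_mem_subspace_eq_self ?_, ?_⟩
  · rw [Submodule.mem_orthogonal_singleton_iff_inner_right]
    simp [inner_sub_left, hex, hey]
  · rw [map_add] at hsum
    rw [map_sub] at hdiff
    have h2 : (2 : ℂ) • R x = (2 : ℂ) • y := by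
      rw [two_smul, two_smul]
      calc R x + R x = (R x + R y) + (R x - R y) := by abel
        _ = y + y := by rw [hsum, hdiff]; abel
    exact smul_right_injective H two_ne_zero h2

/-- The unitary orbit of a non-scalar operator is not totally bounded. -/
theorem exists_seq_linearIsometryEquiv_separated [CompleteSpace H] (hH : ¬ FiniteDimensional ℂ H)
    (T : H →L[ℂ] H) (hT : ¬ ∃ c : ℂ, T = c • (1 : H →L[ℂ] H)) :
    ∃ δ > (0 : ℝ), ∃ R : ℕ → H ≃ₗᵢ[ℂ] H, ∀ m n, m ≠ n →
      δ ≤ ‖(R m).conjStarAlgEquiv T - (R n).conjStarAlgEquiv T‖ := by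
  obtain ⟨e, c, he, hg, horth⟩ : ∃ (e : H) (c : ℂ), ‖e‖ = 1 ∧ T e - c • e ≠ 0 ∧
      inner ℂ (T e - c • e) e = 0 := by
    by_contra! hcon
    apply hT
    obtain ⟨c, hc⟩ := LinearMap.exists_eq_smul_id_of_forall_notLinearIndependent
      (f := (T : H →ₗ[ℂ] H)) fun v hv => by
        have hv0 : v ≠ 0 := by simpa using hv.ne_zero 0
        set e : H := (‖v‖⁻¹ : ℂ) • v
        have he : ‖e‖ = 1 := norm_smul_inv_norm hv0
        have hmem : T e - (inner ℂ e (T e)) • e ≠ 0 := fun h0 => by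
          rw [LinearIndependent.pair_iff] at hv
          have hn : (‖v‖⁻¹ : ℂ) ≠ 0 := by simpa using hv0
          obtain ⟨-, h⟩ := hv (-(inner ℂ e (T e)) * (‖v‖⁻¹ : ℂ)) (‖v‖⁻¹ : ℂ) (by
            rw [mul_smul, neg_smul, neg_add_eq_sub]
            simpa [e] using h0)
          exact hn h
        refine hcon e _ he hmem ?_
        simp [inner_self_eq_norm_sq_to_K, he]
    exact ⟨c, ContinuousLinearMap.ext fun x => by simpa using LinearMap.congr_fun hc x⟩
  set g := T e - c • e
  have hgpos : 0 < ‖g‖ := norm_pos_iff.mpr hg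
  let S : Submodule ℂ H := Submodule.span ℂ {e, g}
  have : FiniteDimensional ℂ S := FiniteDimensional.span_of_finite ℂ (Set.toFinite _)
  obtain ⟨v, hv⟩ := exists_orthonormal_nat (not_finiteDimensional_orthogonal S hH)
  have hperp (n : ℕ) (x : H) (hx : x ∈ S) : inner ℂ x (v n : H) = 0 :=
    (Submodule.mem_orthogonal S _).mp (v n).2 x hx
  have hR (n : ℕ) : ∃ R : H ≃ₗᵢ[ℂ] H, R e = e ∧ R g = (‖g‖ : ℂ) • (v n : H) := by
    refine exists_linearIsometryEquiv_fix_and_map horth ?_ ?_ ?_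
    · rw [inner_smul_left, inner_eq_zero_symm.mp (hperp n e (Submodule.subset_span (by simp))),
        mul_zero]
    · rw [inner_smul_right, hperp n g (Submodule.subset_span (by simp)), mul_zero]
    · have : ‖(v n : H)‖ = 1 := hv.1 n
      simp [norm_smul, this]
  choose R hRe hRg using hR
  refine ⟨‖g‖, hgpos, R, fun m n hmn => ?_⟩
  have happ (k : ℕ) : (R k).conjStarAlgEquiv T e = c • e + (‖g‖ : ℂ) • (v k : H) := by
    have hse : (R k).symm e = e := by rw [LinearIsometryEquiv.symm_apply_eq, hRe]
    have hTe : T e = c • e + g := by simp [g]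
    rw [LinearIsometryEquiv.conjStarAlgEquiv_apply_apply, hse, hTe, map_add, map_smul, hRe, hRg]
  have hle := ((R m).conjStarAlgEquiv T - (R n).conjStarAlgEquiv T).le_opNorm e
  rw [sub_apply, happ, happ, he, mul_one, add_sub_add_left_eq_sub, ← smul_sub, norm_smul] at hle
  have h1 : 1 ≤ ‖(v m : H) - v n‖ := hv.one_le_norm_sub hmn
  refine le_trans ?_ hle
  simpa using le_mul_of_one_le_right hgpos.le h1

theorem ContinuousLinearMap.comm_starProjection {p : Submodule ℂ H} [p.HasOrthogonalProjection]
    {T : H →L[ℂ] H} (h1 : ∀ x ∈ p, T x ∈ p) (h2 : ∀ x ∈ pᗮ, T x ∈ pᗮ) :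
    p.starProjection * T = T * p.starProjection := by
  ext x
  refine (Submodule.eq_starProjection_of_mem_orthogonal
    (h1 _ (p.starProjection_apply_mem x)) ?_)
  have := h2 _ (p.sub_starProjection_mem_orthogonal x)
  simpa using this

theorem finiteDimensional_of_forall_scalar [Nontrivial H]
    (h : ∀ T : H →L[ℂ] H, ∃ c : ℂ, T = c • (1 : H →L[ℂ] H)) : FiniteDimensional ℂ H := by
  obtain ⟨v, hv⟩ := exists_ne (0 : H)
  refine Module.finite_of_finrank_eq_succ (n := 0) (finrank_eq_one (R := ℂ) v hv fun w => ?_)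
  obtain ⟨c, hc⟩ := h ((innerSL ℂ v).smulRight w)
  have hc := congr($hc v)
  have hne : inner ℂ v v ≠ 0 := inner_self_ne_zero.mpr hv
  refine ⟨(inner ℂ v v)⁻¹ * c, ?_⟩
  rw [mul_smul, inv_smul_eq_iff₀ hne]
  simpa using hc.symm

end HilbertSpace

section Representation

variable {A : Type*} [CStarAlgebra A] {H : Type*} [NormedAddCommGroup H] [InnerProductSpace ℂ H]
  [CompleteSpace H]

theorem continuous_representation (π : A →⋆ₐ[ℂ] (H →L[ℂ] H)) : Continuous π := by
  have := NonUnitalStarAlgHom.instContinuousLinearMapClassComplex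
    (F := A →⋆ₐ[ℂ] (H →L[ℂ] H)) (A := A) (B := H →L[ℂ] H)
  exact map_continuous π

theorem denseRange_apply_of_irreducible (π : A →⋆ₐ[ℂ] (H →L[ℂ] H))
    (hπ : ∀ T : H →L[ℂ] H, (∀ a : A, T * π a = π a * T) → ∃ c : ℂ, T = c • (1 : H →L[ℂ] H))
    {v : H} (hv : v ≠ 0) : DenseRange fun a => π a v := by
  let q : Submodule ℂ H := LinearMap.range
    ((ContinuousLinearMap.apply ℂ H v : (H →L[ℂ] H) →ₗ[ℂ] H) ∘ₗ (π : A →ₗ[ℂ] (H →L[ℂ] H)))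
  have hq (a b : A) : π a (π b v) ∈ q := ⟨a * b, by simp⟩
  let p := q.topologicalClosure
  have : CompleteSpace p := q.isClosed_topologicalClosure.completeSpace_coe
  have hinv (a : A) (x : H) (hx : x ∈ p) : π a x ∈ p := by
    refine map_mem_closure (π a).continuous hx ?_
    rintro _ ⟨b, rfl⟩
    exact hq a b
  have hinv' (a : A) (x : H) (hx : x ∈ pᗮ) : π a x ∈ pᗮ := by
    intro y hy
    have h : inner ℂ (π (star a) y) x = 0 := hx _ (hinv _ y hy)
    rwa [map_star, ContinuousLinearMap.star_eq_adjoint,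
      ContinuousLinearMap.adjoint_inner_left] at h
  obtain ⟨c, hc⟩ := hπ p.starProjection fun a =>
    ContinuousLinearMap.comm_starProjection (hinv a) (hinv' a)
  have hvp : v ∈ p := q.le_topologicalClosure ⟨1, by simp⟩
  have hcv : c • v = v := by
    simpa [hc] using Submodule.starProjection_eq_self_iff.mpr hvp
  have hc1 : c = 1 := by
    refine smul_left_injective ℂ hv ?_
    simpa using hcv
  intro x
  have hx : p.starProjection x = x := by simp [hc, hc1]
  have hxp : x ∈ p := Submodule.starProjection_eq_self_iff.mp hx
  exact hxp

theorem exists_mem_not_scalar_of_generates {K : Set A} (hgen : Generates K)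
    (π : A →⋆ₐ[ℂ] (H →L[ℂ] H))
    (hπ : ∀ T : H →L[ℂ] H, (∀ a : A, T * π a = π a * T) → ∃ c : ℂ, T = c • (1 : H →L[ℂ] H))
    [Nontrivial H] (hH : ¬ FiniteDimensional ℂ H) :
    ∃ a ∈ K, ¬ ∃ c : ℂ, π a = c • (1 : H →L[ℂ] H) := by
  by_contra! hK
  refine hH (finiteDimensional_of_forall_scalar fun T => hπ T fun a => ?_)
  let C : StarSubalgebra ℂ A := (StarSubalgebra.centralizer ℂ {T}).comap π
  have hKC : K ⊆ C := fun a ha => by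
    obtain ⟨c, hc⟩ := hK a ha
    simp [C, hc]
  have hclosed : IsClosed (C : Set A) :=
    (Set.isClosed_centralizer _).preimage (continuous_representation π)
  have hle := StarSubalgebra.topologicalClosure_minimal (StarAlgebra.adjoin_le hKC) hclosed
  have ha : a ∈ C := hle (hgen ▸ StarSubalgebra.mem_top)
  exact ((StarSubalgebra.mem_centralizer_iff ℂ).mp ha T rfl).1

theorem norm_sub_le_dRep {K : Set A} (hK : IsCompact K) (π₁ π₂ : RepSp A) {a : A} (ha : a ∈ K) :
    ‖π₁ a - π₂ a‖ ≤ dRep K π₁ π₂ := by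
  obtain ⟨C, hC⟩ := hK.isBounded.exists_norm_le
  have hC0 : 0 ≤ C := (norm_nonneg a).trans (hC a ha)
  have hbdd : BddAbove (Set.range fun b => ⨆ _ : b ∈ K, ‖π₁ b - π₂ b‖) := by
    refine ⟨C + C, ?_⟩
    rintro _ ⟨b, rfl⟩
    refine Real.iSup_le (fun hb => ?_) (by positivity)
    have h₁ := (NonUnitalStarAlgHom.norm_apply_le π₁ b).trans (hC b hb)
    have h₂ := (NonUnitalStarAlgHom.norm_apply_le π₂ b).trans (hC b hb)
    linarith [norm_sub_le (π₁ b) (π₂ b)]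
  refine le_trans ?_ (le_ciSup hbdd a)
  rw [ciSup_pos ha]

theorem sigma0_subset_sigmaSet (K : Set A) : Sigma0 A ⊆ SigmaSet K :=
  fun π hπ ε hε => ⟨π, hπ, by simpa [dRep] using hε⟩

/-- The representation on `ℓ²` obtained by transporting `π` along the unitary `U`. -/
def conjRep (π : A →⋆ₐ[ℂ] (H →L[ℂ] H)) (U : H ≃ₗᵢ[ℂ] H2) : RepSp A :=
  (U.conjStarAlgEquiv : (H →L[ℂ] H) →⋆ₐ[ℂ] BH).comp π

theorem conjRep_apply (π : A →⋆ₐ[ℂ] (H →L[ℂ] H)) (U : H ≃ₗᵢ[ℂ] H2) (a : A) :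
    conjRep π U a = U.conjStarAlgEquiv (π a) := rfl

theorem isIrredRep_conjRep (π : A →⋆ₐ[ℂ] (H →L[ℂ] H))
    (hπ : ∀ T : H →L[ℂ] H, (∀ a : A, T * π a = π a * T) → ∃ c : ℂ, T = c • (1 : H →L[ℂ] H))
    (U : H ≃ₗᵢ[ℂ] H2) : IsIrredRep (conjRep π U) := by
  intro T hT
  obtain ⟨c, hc⟩ := hπ (U.conjStarAlgEquiv.symm T) fun a => by
    have h := congr(U.conjStarAlgEquiv.symm $(hT a))
    simpa only [conjRep_apply, map_mul, StarAlgEquiv.symm_apply_apply] using h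
  refine ⟨c, ?_⟩
  rw [← U.conjStarAlgEquiv.apply_symm_apply T, hc, map_smul, map_one]

end Representation

theorem stmt15 (A : Type*) [CStarAlgebra A] [TopologicalSpace.SeparableSpace A]
    (K : Set A) (hK : IsCompact K) (hgen : Generates K)
    (hcomp : RepSeqCompact K (SigmaSet K)) :
    ∀ (H : Type u) [NormedAddCommGroup H] [InnerProductSpace ℂ H]
      [CompleteSpace H] [Nontrivial H] (π : A →⋆ₐ[ℂ] (H →L[ℂ] H)),
      (∀ T : H →L[ℂ] H, (∀ a : A, T * π a = π a * T) →
        ∃ c : ℂ, T = c • (1 : H →L[ℂ] H)) →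
      FiniteDimensional ℂ H := by
  intro H _ _ _ _ π hπ
  by_contra hH
  obtain ⟨v, hv⟩ := exists_ne (0 : H)
  have : TopologicalSpace.SeparableSpace H :=
    (denseRange_apply_of_irreducible π hπ hv).separableSpace
      ((ContinuousLinearMap.apply ℂ H v).continuous.comp (continuous_representation π))
  obtain ⟨U⟩ := exists_linearIsometryEquiv_lp_nat hH
  obtain ⟨a, haK, ha⟩ := exists_mem_not_scalar_of_generates hgen π hπ hH
  obtain ⟨δ, hδ, R, hR⟩ := exists_seq_linearIsometryEquiv_separated hH (π a) ha
  let σ (n : ℕ) : RepSp A := conjRep π ((R n).trans U)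
  have hσ (m n : ℕ) (hmn : m ≠ n) : δ ≤ ‖σ m a - σ n a‖ := by
    have : σ m a - σ n a = U.conjStarAlgEquiv
        ((R m).conjStarAlgEquiv (π a) - (R n).conjStarAlgEquiv (π a)) := by
      rw [map_sub]
      rfl
    rw [this, NonUnitalStarAlgHom.norm_map U.conjStarAlgEquiv U.conjStarAlgEquiv.injective]
    exact hR m n hmn
  obtain ⟨τ, -, φ, hφ, hlim⟩ := hcomp σ fun n =>
    sigma0_subset_sigmaSet K (Or.inl (isIrredRep_conjRep π hπ _))
  obtain ⟨N, hN⟩ := Filter.eventually_atTop.mp (hlim.eventually_lt_const (half_pos hδ))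
  have h (k : ℕ) (hk : N ≤ k) : ‖σ (φ k) a - τ a‖ < δ / 2 :=
    (norm_sub_le_dRep hK _ _ haK).trans_lt (hN k hk)
  have htri := norm_sub_le_norm_sub_add_norm_sub (σ (φ N) a) (τ a) (σ (φ (N + 1)) a)
  rw [norm_sub_rev (τ a)] at htri
  linarith [h N le_rfl, h (N + 1) (by lia), hσ _ _ (hφ.injective.ne N.lt_succ_self.ne)]
end
end
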